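/- arXiv:2601.02682 — 2 statements merged into one kernel-verified Lean document; each statement's English description precedes it below -/
import Mathlib

section
/- Let D, W, K be positive integers, let 𝓡 ⊆ {1,…,W} be nonempty with |𝓡| = R, let L > 0, ξ ≥ 0, A ≥ 0, and set δ = 1 − R/W. For each w ∈ {1,…,W} let f̂_w : ℝ^D → ℝ be differentiable with L-Lipschitz gradient, set f = (1/R)·Σ_{w∈𝓡} f̂_w, and assume: f(x) ≥ f* for all x; sup_x max_{w∈𝓡} ‖∇f̂_w(x) − ∇f(x)‖ ≤ ξ; and sup_x max_{w∉𝓡} ‖∇f̂_w(x) − ∇f(x)‖ ≤ A. Let E ∈ ℝ^{W×W} be doubly stochastic with λ' = ‖E − (1/W)𝟙𝟙ᵀ‖ < 1 (operator 2-norm), and assume K ≥ max{24λ'²L²/(1−λ')², L²}. Set γ = 1/√K and define iterates by x̂_w^0 = x^0 for all w and x̂_w^{k+1} = Σ_{v=1}^W E_{wv}·(x̂_v^k − γ∇f̂_v(x̂_v^k)). Then, with x̄^k = (1/R)Σ_{w∈𝓡} x̂_w^k, (1/K)·Σ_{k=0}^{K−1} ‖∇f(x̄^k)‖² ≤ 4(f(x^0)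 − f*)/√K + 144L²W·λ'²·(δ²A² + max{ξ², A²})/(R·(1−λ')²·K) + 4δ²A². -/
open Finset

/-- A matrix acting on a tuple of vectors is bounded, in the Frobenius norm, by its operator
2-norm. -/
lemma norm_toLp_matrix_smul_le {ι κ : Type*} [Fintype ι] [DecidableEq ι] [Fintype κ]
    (B : Matrix ι ι ℝ) (z : ι → EuclideanSpace ℝ κ) :
    ‖WithLp.toLp 2 (fun w => ∑ v, B w v • z v)‖ ≤
      ‖Matrix.toEuclideanCLM (𝕜 := ℝ) B‖ * ‖WithLp.toLp 2 z‖ := by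
  refine le_of_sq_le_sq ?_ (by positivity)
  rw [mul_pow, PiLp.norm_sq_eq_of_L2, PiLp.norm_sq_eq_of_L2]
  simp only [EuclideanSpace.real_norm_sq_eq]
  rw [Finset.sum_comm, Finset.sum_comm (s := Finset.univ) (t := Finset.univ)
    (f := fun (v : ι) (d : κ) => (z v d) ^ 2), Finset.mul_sum]
  refine Finset.sum_le_sum fun d _ => ?_
  have h := (Matrix.toEuclideanCLM (𝕜 := ℝ) B).le_opNorm (WithLp.toLp 2 fun v => z v d)
  have h2 := pow_le_pow_left₀ (norm_nonneg _) h 2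
  rw [mul_pow, EuclideanSpace.real_norm_sq_eq, EuclideanSpace.real_norm_sq_eq] at h2
  simpa [Matrix.mulVec, dotProduct] using h2

/-- Jensen's inequality for the squared norm of a finite average. -/
lemma norm_sq_average_le {ι V : Type*} [SeminormedAddCommGroup V] [NormedSpace ℝ V]
    (s : Finset ι) (u : ι → V) :
    ‖(s.card : ℝ)⁻¹ • ∑ i ∈ s, u i‖ ^ 2 ≤ (s.card : ℝ)⁻¹ * ∑ i ∈ s, ‖u i‖ ^ 2 := by
  rcases s.eq_empty_or_nonempty with rfl | hs
  · simp
  have hc : (0 : ℝ) < s.card := by exact_mod_cast hs.card_pos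
  have h : ‖∑ i ∈ s, u i‖ ^ 2 ≤ s.card * ∑ i ∈ s, ‖u i‖ ^ 2 :=
    (pow_le_pow_left₀ (norm_nonneg _) (norm_sum_le _ _) 2).trans sq_sum_le_card_mul_sum_sq
  rw [norm_smul, mul_pow, Real.norm_of_nonneg (by positivity)]
  calc ((s.card : ℝ)⁻¹) ^ 2 * ‖∑ i ∈ s, u i‖ ^ 2
      ≤ ((s.card : ℝ)⁻¹) ^ 2 * (s.card * ∑ i ∈ s, ‖u i‖ ^ 2) := by gcongr
    _ = (s.card : ℝ)⁻¹ * ∑ i ∈ s, ‖u i‖ ^ 2 := by field_simp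

lemma norm_sq_add_le_two_mul {V : Type*} [SeminormedAddCommGroup V] (a b : V) :
    ‖a + b‖ ^ 2 ≤ 2 * ‖a‖ ^ 2 + 2 * ‖b‖ ^ 2 := by
  have h := pow_le_pow_left₀ (norm_nonneg _) (norm_add_le a b) 2
  nlinarith [sq_nonneg (‖a‖ - ‖b‖)]

section Smooth

variable {V : Type*} [NormedAddCommGroup V] [InnerProductSpace ℝ V] [CompleteSpace V]

/-- The quadratic upper bound for a function with Lipschitz gradient. -/
lemma le_quadratic_of_lipschitz_gradient {F : V → ℝ} {L : ℝ} (hF : Differentiable ℝ F)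
    (hlip : ∀ x y, ‖gradient F x - gradient F y‖ ≤ L * ‖x - y‖) (x y : V) :
    F y ≤ F x + inner ℝ (gradient F x) (y - x) + L / 2 * ‖y - x‖ ^ 2 := by
  set d := y - x with hd
  let φ : ℝ → ℝ := fun t =>
    F (x + t • d) - t * inner ℝ (gradient F x) d - L / 2 * t ^ 2 * ‖d‖ ^ 2
  have hφ : ∀ t, HasDerivAt φ (inner ℝ (gradient F (x + t • d)) d
      - inner ℝ (gradient F x) d - L * t * ‖d‖ ^ 2) t := by
    intro t
    have hline : HasDerivAt (fun t : ℝ => x + t • d) d t := by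
      simpa using ((hasDerivAt_id t).smul_const d).const_add x
    have hcomp := ((hF (x + t • d)).hasGradientAt.hasFDerivAt).comp_hasDerivAt t hline
    have hlin := (hasDerivAt_id t).mul_const (inner ℝ (gradient F x) d)
    have hquad := (((hasDerivAt_id t).pow 2).const_mul (L / 2)).mul_const (‖d‖ ^ 2)
    refine ((hcomp.sub hlin).sub hquad).congr_deriv ?_
    simp only [InnerProductSpace.toDual_apply_apply, id_eq, Nat.cast_ofNat]
    ring
  have hanti : AntitoneOn φ (Set.Icc 0 1) := by
    refine antitoneOn_of_deriv_nonpos (convex_Icc 0 1)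
      (fun t _ => (hφ t).continuousAt.continuousWithinAt)
      (fun t _ => (hφ t).differentiableAt.differentiableWithinAt) fun t ht => ?_
    rw [interior_Icc] at ht
    rw [(hφ t).deriv, ← inner_sub_left]
    have h1 := real_inner_le_norm (gradient F (x + t • d) - gradient F x) d
    have h2 := hlip (x + t • d) x
    rw [add_sub_cancel_left, norm_smul, Real.norm_of_nonneg ht.1.le] at h2
    nlinarith [mul_le_mul_of_nonneg_right h2 (norm_nonneg d)]
  have h := hanti (Set.left_mem_Icc.2 zero_le_one) (Set.right_mem_Icc.2 zero_le_one) zero_le_one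
  have hxd : x + d = y := add_sub_cancel x y
  simp only [φ, one_smul, zero_smul, add_zero, hxd] at h
  linarith

/-- One inexact gradient step of size `γ ≤ 1 / L` decreases the objective up to the squared
error of the direction `g`. -/
lemma inexact_gradient_step_le {F : V → ℝ} {L γ : ℝ} (hF : Differentiable ℝ F)
    (hlip : ∀ x y, ‖gradient F x - gradient F y‖ ≤ L * ‖x - y‖)
    (hγ : 0 ≤ γ) (hγL : γ * L ≤ 1) (x g : V) :
    F (x - γ • g) ≤ F x - γ / 2 * ‖gradient F x‖ ^ 2 + γ / 2 * ‖g - gradient F x‖ ^ 2 := by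
  have h := le_quadratic_of_lipschitz_gradient hF hlip x (x - γ • g)
  rw [sub_sub_cancel_left, inner_neg_right, norm_neg, norm_smul, Real.norm_of_nonneg hγ,
    real_inner_smul_right] at h
  have h2 := norm_sub_sq_real g (gradient F x)
  rw [real_inner_comm] at h2
  rw [h2]
  nlinarith [mul_le_mul_of_nonneg_right hγL (mul_nonneg hγ (sq_nonneg ‖g‖))]

lemma hasGradientAt_average {ι : Type*} (s : Finset ι) (f : ι → V → ℝ) (c : ℝ)
    (hdiff : ∀ i, Differentiable ℝ (f i)) (x : V) :
    HasGradientAt (fun y => c * ∑ i ∈ s, f i y) (c • ∑ i ∈ s, gradient (f i) x) x := by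
  rw [hasGradientAt_iff_hasFDerivAt]
  have h := (HasFDerivAt.fun_sum fun i (_ : i ∈ s) =>
    (hdiff i x).hasGradientAt.hasFDerivAt).const_mul c
  simpa [map_sum] using h

/-- The average of functions with `L`-Lipschitz gradients has an `L`-Lipschitz gradient. -/
lemma lipschitz_gradient_average {ι : Type*} {s : Finset ι} (hs : s.Nonempty) {f : ι → V → ℝ}
    {L : ℝ} (hdiff : ∀ i, Differentiable ℝ (f i))
    (hlip : ∀ i, ∀ x y, ‖gradient (f i) x - gradient (f i) y‖ ≤ L * ‖x - y‖) (x y : V) :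
    ‖gradient (fun z => (s.card : ℝ)⁻¹ * ∑ i ∈ s, f i z) x
      - gradient (fun z => (s.card : ℝ)⁻¹ * ∑ i ∈ s, f i z) y‖ ≤ L * ‖x - y‖ := by
  have hc : (0 : ℝ) < s.card := by exact_mod_cast hs.card_pos
  rw [(hasGradientAt_average s f _ hdiff x).gradient, (hasGradientAt_average s f _ hdiff y).gradient,
    ← smul_sub, ← Finset.sum_sub_distrib, norm_smul, Real.norm_of_nonneg (by positivity)]
  calc (s.card : ℝ)⁻¹ * ‖∑ i ∈ s, (gradient (f i) x - gradient (f i) y)‖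
      ≤ (s.card : ℝ)⁻¹ * ∑ i ∈ s, L * ‖x - y‖ := by
        gcongr
        exact norm_sum_le_of_le _ fun i _ => hlip i x y
    _ = L * ‖x - y‖ := by
        rw [Finset.sum_const, nsmul_eq_mul]
        field_simp

end Smooth

/-- An affine recursion with nonnegative slope stays below any supersolution `c`. -/
lemma affine_recursion_le {a : ℕ → ℝ} {q b c : ℝ} (hq : 0 ≤ q) (h0 : a 0 ≤ c)
    (hstep : ∀ k, a (k + 1) ≤ q * a k + b) (hc : q * c + b ≤ c) (k : ℕ) : a k ≤ c := by
  induction k with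
  | zero => exact h0
  | succ k ih => exact (hstep k).trans ((by gcongr : q * a k + b ≤ q * c + b).trans hc)

section Consensus

variable {D W : ℕ}

/-- The average of the iterates performs an averaged gradient step when the columns of the
mixing matrix sum to one. -/
lemma average_mixing_step {V : Type*} [AddCommGroup V] [Module ℝ V]
    {E : Matrix (Fin W) (Fin W) ℝ} (hEcol : ∀ v, ∑ w, E w v = 1) (γ : ℝ) (x g y : Fin W → V)
    (hstep : ∀ w, y w = ∑ v, E w v • (x v - γ • g v)) :
    (W : ℝ)⁻¹ • ∑ w, y w = (W : ℝ)⁻¹ • ∑ w, x w - γ • ((W : ℝ)⁻¹ • ∑ w, g w) := by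
  simp only [hstep]
  rw [Finset.sum_comm]
  simp only [← Finset.sum_smul, hEcol, one_smul, Finset.sum_sub_distrib, ← Finset.smul_sum]
  rw [smul_sub, smul_comm]

/-- Deviations from the average are mixed by `E - J`, and any common vector `c` may be
subtracted from the directions. -/
lemma deviation_mixing_step {V : Type*} [AddCommGroup V] [Module ℝ V] (hW : 0 < W)
    {E : Matrix (Fin W) (Fin W) ℝ} (hErow : ∀ w, ∑ v, E w v = 1) (hEcol : ∀ v, ∑ w, E w v = 1)
    {J : Matrix (Fin W) (Fin W) ℝ} (hJ : J = Matrix.of fun _ _ => (W : ℝ)⁻¹)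
    (γ : ℝ) (x g y : Fin W → V) (hstep : ∀ w, y w = ∑ v, E w v • (x v - γ • g v))
    (m c : V) (w : Fin W) :
    y w - (W : ℝ)⁻¹ • ∑ v, y v =
      ∑ v, (E - J) w v • ((x v - m) - γ • (g v - c)) := by
  have hW' : (W : ℝ) ≠ 0 := by positivity
  have hB : ∑ v, (E - J) w v = 0 := by
    simp [hJ, Matrix.sub_apply, Finset.sum_sub_distrib, hErow, hW']
  have hsplit : ∀ v, (x v - m) - γ • (g v - c) = (x v - γ • g v) - (m - γ • c) := by
    intro v
    module
  have havg := average_mixing_step hEcol γ x g y hstep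
  simp only [hsplit, smul_sub _ (x _ - γ • g _), Finset.sum_sub_distrib]
  rw [← Finset.sum_smul, hB, zero_smul, sub_zero, havg, hstep w]
  simp only [hJ, Matrix.sub_apply, Matrix.of_apply, sub_smul, Finset.sum_sub_distrib,
    ← Finset.smul_sum, smul_sub]
  rw [smul_comm]
  abel

/-- If the directions are within `M` of a common vector up to an `L`-Lipschitz error in the
deviations, one mixing step bounds the new deviation. -/
lemma norm_deviation_step_le (hW : 0 < W)
    {E : Matrix (Fin W) (Fin W) ℝ} (hErow : ∀ w, ∑ v, E w v = 1) (hEcol : ∀ v, ∑ w, E w v = 1)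
    {J : Matrix (Fin W) (Fin W) ℝ} (hJ : J = Matrix.of fun _ _ => (W : ℝ)⁻¹)
    {γ L M : ℝ} (hγ : 0 ≤ γ) (hL : 0 ≤ L) (hM : 0 ≤ M)
    (x g y : Fin W → EuclideanSpace ℝ (Fin D))
    (hstep : ∀ w, y w = ∑ v, E w v • (x v - γ • g v)) (m c : EuclideanSpace ℝ (Fin D))
    (h : Fin W → EuclideanSpace ℝ (Fin D))
    (hg : ∀ v, ‖g v - h v‖ ≤ L * ‖x v - m‖) (hh : ∀ v, ‖h v - c‖ ≤ M) :
    ‖WithLp.toLp 2 (fun w => y w - (W : ℝ)⁻¹ • ∑ v, y v)‖ ≤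
      ‖Matrix.toEuclideanCLM (𝕜 := ℝ) (E - J)‖ *
        ((1 + γ * L) * ‖WithLp.toLp 2 (fun v => x v - m)‖ + γ * (√W * M)) := by
  simp only [deviation_mixing_step hW hErow hEcol hJ γ x g y hstep m c]
  refine (norm_toLp_matrix_smul_le _ _).trans ?_
  gcongr
  have hsplit : WithLp.toLp 2 (fun v => (x v - m) - γ • (g v - c)) =
      WithLp.toLp 2 (fun v => x v - m) - γ • (WithLp.toLp 2 (fun v => g v - h v)
        + WithLp.toLp 2 (fun v => h v - c)) := by
    ext v
    simp
    ring
  have hLip : ‖WithLp.toLp 2 (fun v => g v - h v)‖ ≤ L * ‖WithLp.toLp 2 (fun v => x v - m)‖ := by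
    refine le_of_sq_le_sq ?_ (by positivity)
    rw [mul_pow, PiLp.norm_sq_eq_of_L2, PiLp.norm_sq_eq_of_L2, Finset.mul_sum]
    refine Finset.sum_le_sum fun v _ => ?_
    rw [← mul_pow]
    exact pow_le_pow_left₀ (norm_nonneg _) (hg v) 2
  have hdev : ‖WithLp.toLp 2 (fun v => h v - c)‖ ≤ √W * M := by
    refine le_of_sq_le_sq ?_ (by positivity)
    rw [mul_pow, PiLp.norm_sq_eq_of_L2, Real.sq_sqrt (by positivity)]
    calc ∑ v, ‖h v - c‖ ^ 2 ≤ ∑ _v : Fin W, M ^ 2 :=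
          Finset.sum_le_sum fun v _ => pow_le_pow_left₀ (norm_nonneg _) (hh v) 2
      _ = W * M ^ 2 := by simp
  rw [hsplit]
  refine (norm_sub_le _ _).trans ?_
  rw [norm_smul, Real.norm_of_nonneg hγ]
  have := (norm_add_le (WithLp.toLp 2 (fun v => g v - h v))
    (WithLp.toLp 2 (fun v => h v - c))).trans (add_le_add hLip hdev)
  nlinarith [mul_le_mul_of_nonneg_left this hγ]

end Consensus

/-- The mean gradient over all agents differs from the regular objective's gradient by at most
the fraction of poisoned agents times their deviation. -/
lemma norm_average_sub_regular_average_le {V : Type*} [NormedAddCommGroup V] [NormedSpace ℝ V]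
    {W : ℕ} (hW : 0 < W) {s : Finset (Fin W)} (hs : s.Nonempty) (h : Fin W → V) {A : ℝ}
    (hA : ∀ w ∉ s, ‖h w - (s.card : ℝ)⁻¹ • ∑ v ∈ s, h v‖ ≤ A) :
    ‖(W : ℝ)⁻¹ • ∑ w, (h w - (s.card : ℝ)⁻¹ • ∑ v ∈ s, h v)‖ ≤ (1 - s.card / W) * A := by
  have hc : (s.card : ℝ) ≠ 0 := by exact_mod_cast hs.card_pos.ne'
  have hW' : (0 : ℝ) < W := by exact_mod_cast hW
  have hreg : ∑ w ∈ s, (h w - (s.card : ℝ)⁻¹ • ∑ v ∈ s, h v) = 0 := by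
    rw [Finset.sum_sub_distrib, Finset.sum_const, ← Nat.cast_smul_eq_nsmul ℝ, smul_smul,
      mul_inv_cancel₀ hc, one_smul, sub_self]
  rw [← Finset.sum_add_sum_compl s, hreg, zero_add, norm_smul,
    Real.norm_of_nonneg (by positivity)]
  have hcompl : ((sᶜ.card : ℕ) : ℝ) = W - s.card := by
    rw [Finset.card_compl, Fintype.card_fin,
      Nat.cast_sub (by simpa using Finset.card_le_univ s)]
  calc (W : ℝ)⁻¹ * ‖∑ w ∈ sᶜ, (h w - (s.card : ℝ)⁻¹ • ∑ v ∈ s, h v)‖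
      ≤ (W : ℝ)⁻¹ * ∑ _w ∈ sᶜ, A := by
        gcongr
        exact norm_sum_le_of_le _ fun w hw => hA w (Finset.mem_compl.1 hw)
    _ = (1 - s.card / W) * A := by
        rw [Finset.sum_const, nsmul_eq_mul, hcompl]
        field_simp

/-- Closed form of the consensus contribution to the learning error. -/
lemma consensus_term_le {L W lam γ M B R K : ℝ} (hW : 0 ≤ W) (hK : 0 < K)
    (hR : 0 < R) (hgap : 0 < 1 - lam) (hγ : γ ^ 2 * K = 1) (hM : 24 * M ^ 2 ≤ 144 * B) :
    6 * (L ^ 2 * (4 * lam ^ 2 * γ ^ 2 * W * M ^ 2 / (1 - lam) ^ 2 / R)) ≤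
      144 * L ^ 2 * W * lam ^ 2 * B / (R * (1 - lam) ^ 2 * K) := by
  have hγK : γ ^ 2 = K⁻¹ := eq_inv_of_mul_eq_one_left hγ
  calc 6 * (L ^ 2 * (4 * lam ^ 2 * γ ^ 2 * W * M ^ 2 / (1 - lam) ^ 2 / R))
      = L ^ 2 * W * lam ^ 2 * (24 * M ^ 2) / (R * (1 - lam) ^ 2 * K) := by
        rw [hγK]
        field_simp
        ring
    _ ≤ L ^ 2 * W * lam ^ 2 * (144 * B) / (R * (1 - lam) ^ 2 * K) := by gcongr
    _ = 144 * L ^ 2 * W * lam ^ 2 * B / (R * (1 - lam) ^ 2 * K) := by ring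

/-- Theorem 2 (upper bound on the averaged squared gradient norm) for decentralized
gradient descent with the weighted mean aggregator under label poisoning attacks. -/
theorem weighted_mean_learning_error_upper_bound
    (D W K : ℕ) (hD : 0 < D) (hW : 0 < W) (hK : 0 < K)
    (Reg : Finset (Fin W)) (hReg : Reg.Nonempty)
    (R : ℕ) (hR : R = Reg.card)
    (L ξ A δ : ℝ) (hL : 0 < L) (hξ : 0 ≤ ξ) (hA : 0 ≤ A)
    (hδ : δ = 1 - (R : ℝ) / (W : ℝ))
    (f : Fin W → EuclideanSpace ℝ (Fin D) → ℝ)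
    (hdiff : ∀ w, Differentiable ℝ (f w))
    (hlip : ∀ w, ∀ x y : EuclideanSpace ℝ (Fin D),
      ‖gradient (f w) x - gradient (f w) y‖ ≤ L * ‖x - y‖)
    (F : EuclideanSpace ℝ (Fin D) → ℝ)
    (hF : F = fun y => (R : ℝ)⁻¹ * ∑ w ∈ Reg, f w y)
    (fstar : ℝ) (hlb : ∀ x, F x ≥ fstar)
    (hhet : ∀ (x : EuclideanSpace ℝ (Fin D)), ∀ w ∈ Reg,
      ‖gradient (f w) x - gradient F x‖ ≤ ξ)
    (hdist : ∀ (x : EuclideanSpace ℝ (Fin D)), ∀ w ∉ Reg,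
      ‖gradient (f w) x - gradient F x‖ ≤ A)
    (E : Matrix (Fin W) (Fin W) ℝ)
    (hEnonneg : ∀ w v, 0 ≤ E w v)
    (hErow : ∀ w, ∑ v, E w v = 1) (hEcol : ∀ v, ∑ w, E w v = 1)
    (J : Matrix (Fin W) (Fin W) ℝ) (hJ : J = Matrix.of fun _ _ => (W : ℝ)⁻¹)
    (lam : ℝ) (hlam : lam = ‖Matrix.toEuclideanCLM (𝕜 := ℝ) (E - J)‖)
    (hlam1 : lam < 1)
    (hKbig : (K : ℝ) ≥ max (24 * lam ^ 2 * L ^ 2 / (1 - lam) ^ 2) (L ^ 2))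
    (γ : ℝ) (hγ : γ = 1 / Real.sqrt K)
    (x0 : EuclideanSpace ℝ (Fin D))
    (xhat : ℕ → Fin W → EuclideanSpace ℝ (Fin D))
    (hinit : ∀ w, xhat 0 w = x0)
    (hstep : ∀ k w, xhat (k + 1) w =
      ∑ v, E w v • (xhat k v - γ • gradient (f v) (xhat k v)))
    (xbar : ℕ → EuclideanSpace ℝ (Fin D))
    (hxbar : ∀ k, xbar k = (R : ℝ)⁻¹ • ∑ w ∈ Reg, xhat k w) :
    (K : ℝ)⁻¹ * ∑ k ∈ Finset.range K, ‖gradient F (xbar k)‖ ^ 2 ≤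
      4 * (F x0 - fstar) / Real.sqrt K
      + 144 * L ^ 2 * (W : ℝ) * lam ^ 2 * (δ ^ 2 * A ^ 2 + max (ξ ^ 2) (A ^ 2))
          / ((R : ℝ) * (1 - lam) ^ 2 * (K : ℝ))
      + 4 * δ ^ 2 * A ^ 2 := by
  subst hR
  have hR : (0 : ℝ) < Reg.card := by exact_mod_cast hReg.card_pos
  have hW' : (0 : ℝ) < W := by exact_mod_cast hW
  have hK' : (0 : ℝ) < K := by exact_mod_cast hK
  have hsK : 0 < √(K : ℝ) := Real.sqrt_pos.2 hK'
  have hRW : (Reg.card : ℝ) ≤ W := by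
    exact_mod_cast (by simpa using Finset.card_le_univ Reg : Reg.card ≤ W)
  have hγ0 : 0 < γ := by rw [hγ]; positivity
  have hγsq : γ ^ 2 * K = 1 := by
    rw [hγ, div_pow, Real.sq_sqrt hK'.le]
    field_simp
  have hlam0 : 0 ≤ lam := hlam ▸ norm_nonneg _
  have hgap : 0 < 1 - lam := by linarith
  have hγL : γ * L ≤ 1 := by
    have hLK : L ≤ √(K : ℝ) := Real.le_sqrt_of_sq_le ((le_max_right _ _).trans hKbig)
    rw [hγ, one_div, inv_mul_le_iff₀ hsK]
    linarith
  have hcontr : lam * (γ * L) ≤ (1 - lam) / 2 := by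
    have h := (le_max_left _ _).trans hKbig
    rw [div_le_iff₀ (by positivity)] at h
    refine le_of_sq_le_sq ?_ (by positivity)
    have h2 : γ ^ 2 * (24 * lam ^ 2 * L ^ 2) ≤ (1 - lam) ^ 2 := by
      calc γ ^ 2 * (24 * lam ^ 2 * L ^ 2) ≤ γ ^ 2 * (K * (1 - lam) ^ 2) := by gcongr
        _ = (1 - lam) ^ 2 := by rw [← mul_assoc, hγsq, one_mul]
    nlinarith [sq_nonneg (γ * lam * L)]
  have hgradF : ∀ x, gradient F x = (Reg.card : ℝ)⁻¹ • ∑ w ∈ Reg, gradient (f w) x := fun x => by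
    rw [hF]
    exact (hasGradientAt_average Reg f _ hdiff x).gradient
  have hdiffF : Differentiable ℝ F := fun x => by
    rw [hF]
    exact (hasGradientAt_average Reg f _ hdiff x).differentiableAt
  have hlipF : ∀ x y, ‖gradient F x - gradient F y‖ ≤ L * ‖x - y‖ := by
    rw [hF]
    exact lipschitz_gradient_average hReg hdiff hlip
  set M := max ξ A with hMdef
  have hM0 : 0 ≤ M := hξ.trans (le_max_left _ _)
  have hMsq : M ^ 2 ≤ max (ξ ^ 2) (A ^ 2) := by
    rcases max_choice ξ A with h | h <;> rw [hMdef, h]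
    exacts [le_max_left _ _, le_max_right _ _]
  have hdevM : ∀ x w, ‖gradient (f w) x - gradient F x‖ ≤ M := fun x w => by
    by_cases hw : w ∈ Reg
    exacts [(hhet x w hw).trans (le_max_left _ _), (hdist x w hw).trans (le_max_right _ _)]
  let m : ℕ → EuclideanSpace ℝ (Fin D) := fun k => (W : ℝ)⁻¹ • ∑ w, xhat k w
  have hm0 : m 0 = x0 := by
    simp only [m, hinit, Finset.sum_const, Finset.card_univ, Fintype.card_fin]
    rw [← Nat.cast_smul_eq_nsmul ℝ, smul_smul, inv_mul_cancel₀ hW'.ne', one_smul]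
  -- The consensus error stays of order `γ`.
  have hcons : ∀ k, ‖WithLp.toLp 2 (fun w => xhat k w - m k)‖ ≤
      2 * lam * γ * (√W * M) / (1 - lam) := by
    refine affine_recursion_le (q := lam * (1 + γ * L)) (b := lam * (γ * (√W * M)))
      (by positivity) ?_ (fun k => ?_) ?_
    · have hzero : (WithLp.toLp 2 fun w => xhat 0 w - m 0) = 0 := by
        ext w
        simp [hinit, hm0]
      rw [hzero, norm_zero]
      positivity
    · refine (norm_deviation_step_le hW hErow hEcol hJ hγ0.le hL.le hM0 (xhat k) _
        (xhat (k + 1)) (hstep k) (m k) (gradient F (m k)) (fun v => gradient (f v) (m k))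
        (fun v => hlip v _ _) (hdevM (m k))).trans_eq ?_
      rw [← hlam]
      ring
    · set c := 2 * lam * γ * (√W * M) / (1 - lam) with hc
      have hc0 : 0 ≤ c := by positivity
      have hb : lam * (γ * (√W * M)) = (1 - lam) / 2 * c := by
        rw [hc]
        field_simp
      rw [hb]
      nlinarith [mul_le_mul_of_nonneg_right hcontr hc0]
  set S : ℝ := 4 * lam ^ 2 * γ ^ 2 * W * M ^ 2 / (1 - lam) ^ 2 with hS
  have hS0 : 0 ≤ S := by positivity
  have hconsS : ∀ k, ∑ w, ‖xhat k w - m k‖ ^ 2 ≤ S := fun k => by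
    have h := pow_le_pow_left₀ (norm_nonneg _) (hcons k) 2
    rw [PiLp.norm_sq_eq_of_L2] at h
    refine h.trans_eq ?_
    rw [hS, div_pow, mul_pow, mul_pow _ M, Real.sq_sqrt hW'.le]
    ring
  have hbar : ∀ k, ‖xbar k - m k‖ ^ 2 ≤ S / Reg.card := fun k => by
    have hsub : xbar k - m k = (Reg.card : ℝ)⁻¹ • ∑ w ∈ Reg, (xhat k w - m k) := by
      rw [hxbar, Finset.sum_sub_distrib, smul_sub, Finset.sum_const,
        ← Nat.cast_smul_eq_nsmul ℝ, smul_smul, inv_mul_cancel₀ hR.ne', one_smul]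
    rw [hsub, div_eq_inv_mul]
    refine (norm_sq_average_le _ _).trans ?_
    gcongr
    exact (Finset.sum_le_sum_of_subset_of_nonneg (Finset.subset_univ _)
      fun _ _ _ => by positivity).trans (hconsS k)
  let g : ℕ → EuclideanSpace ℝ (Fin D) := fun k =>
    (W : ℝ)⁻¹ • ∑ w, gradient (f w) (xhat k w)
  have hgerr : ∀ k, ‖g k - gradient F (m k)‖ ^ 2 ≤ 2 * (L ^ 2 * (S / W)) + 2 * (δ * A) ^ 2 := by
    intro k
    have hsplit : g k - gradient F (m k) =
        (W : ℝ)⁻¹ • ∑ w, (gradient (f w) (xhat k w) - gradient (f w) (m k))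
          + (W : ℝ)⁻¹ • ∑ w, (gradient (f w) (m k) - gradient F (m k)) := by
      rw [← smul_add, ← Finset.sum_add_distrib]
      simp only [sub_add_sub_cancel]
      rw [Finset.sum_sub_distrib, smul_sub, Finset.sum_const, Finset.card_univ,
        Fintype.card_fin, ← Nat.cast_smul_eq_nsmul ℝ, smul_smul, inv_mul_cancel₀ hW'.ne',
        one_smul]
    rw [hsplit]
    refine (norm_sq_add_le_two_mul _ _).trans ?_
    gcongr
    · have h := norm_sq_average_le Finset.univ
        fun w => gradient (f w) (xhat k w) - gradient (f w) (m k)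
      rw [Finset.card_univ, Fintype.card_fin] at h
      refine h.trans ?_
      rw [div_eq_inv_mul, mul_left_comm]
      gcongr
      calc ∑ w, ‖gradient (f w) (xhat k w) - gradient (f w) (m k)‖ ^ 2
          ≤ ∑ w, L ^ 2 * ‖xhat k w - m k‖ ^ 2 := Finset.sum_le_sum fun w _ => by
            rw [← mul_pow]
            exact pow_le_pow_left₀ (norm_nonneg _) (hlip w _ _) 2
        _ ≤ L ^ 2 * S := by
            rw [← Finset.mul_sum]
            gcongr
            exact hconsS k
    · rw [hδ, hgradF]
      refine norm_average_sub_regular_average_le hW hReg (fun w => gradient (f w) (m k))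
        fun w hw => ?_
      rw [← hgradF]
      exact hdist _ w hw
  have hper : ∀ k, ‖gradient F (xbar k)‖ ^ 2 ≤
      4 / γ * (F (m k) - F (m (k + 1))) + (6 * (L ^ 2 * (S / Reg.card)) + 4 * δ ^ 2 * A ^ 2) := by
    intro k
    have hdesc := inexact_gradient_step_le hdiffF hlipF hγ0.le hγL (m k) (g k)
    rw [← average_mixing_step hEcol γ (xhat k) _ (xhat (k + 1)) (hstep k)] at hdesc
    change F (m (k + 1)) ≤ _ at hdesc
    have hgrad : ‖gradient F (m k)‖ ^ 2 ≤
        2 / γ * (F (m k) - F (m (k + 1))) + ‖g k - gradient F (m k)‖ ^ 2 := by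
      have h := mul_le_mul_of_nonneg_left hdesc (by positivity : 0 ≤ 2 / γ)
      have e : 2 / γ * (γ / 2) = 1 := by field_simp
      linear_combination h + (‖g k - gradient F (m k)‖ ^ 2 - ‖gradient F (m k)‖ ^ 2) * e
    have htri := norm_sq_add_le_two_mul (gradient F (m k))
      (gradient F (xbar k) - gradient F (m k))
    rw [add_sub_cancel] at htri
    have hlipbar : ‖gradient F (xbar k) - gradient F (m k)‖ ^ 2 ≤ L ^ 2 * (S / Reg.card) := by
      refine (pow_le_pow_left₀ (norm_nonneg _) (hlipF _ _) 2).trans ?_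
      rw [mul_pow]
      gcongr
      exact hbar k
    have hSW : L ^ 2 * (S / W) ≤ L ^ 2 * (S / Reg.card) := by gcongr
    have h4 : 4 / γ = 2 * (2 / γ) := by ring
    rw [h4]
    linarith [hgerr k]
  have hsum : ∑ k ∈ Finset.range K, ‖gradient F (xbar k)‖ ^ 2 ≤
      4 / γ * (F x0 - fstar) + K * (6 * (L ^ 2 * (S / Reg.card)) + 4 * δ ^ 2 * A ^ 2) := by
    refine (Finset.sum_le_sum fun k _ => hper k).trans ?_
    rw [Finset.sum_add_distrib, ← Finset.mul_sum, Finset.sum_range_sub', hm0, Finset.sum_const,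
      Finset.card_range, nsmul_eq_mul]
    gcongr
    exact hlb _
  have hfirst : (K : ℝ)⁻¹ * (4 / γ * (F x0 - fstar)) = 4 * (F x0 - fstar) / √K := by
    rw [hγ]
    field_simp
    rw [Real.sq_sqrt hK'.le]
  have hsecond : 6 * (L ^ 2 * (S / Reg.card)) ≤
      144 * L ^ 2 * (W : ℝ) * lam ^ 2 * (δ ^ 2 * A ^ 2 + max (ξ ^ 2) (A ^ 2))
        / ((Reg.card : ℝ) * (1 - lam) ^ 2 * K) := by
    rw [hS]
    refine consensus_term_le hW'.le hK' hR hgap hγsq ?_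
    nlinarith [sq_nonneg (δ * A), sq_nonneg M]
  calc (K : ℝ)⁻¹ * ∑ k ∈ Finset.range K, ‖gradient F (xbar k)‖ ^ 2
      ≤ (K : ℝ)⁻¹ * (4 / γ * (F x0 - fstar)
          + K * (6 * (L ^ 2 * (S / Reg.card)) + 4 * δ ^ 2 * A ^ 2)) := by gcongr
    _ = 4 * (F x0 - fstar) / √K + 6 * (L ^ 2 * (S / Reg.card)) + 4 * δ ^ 2 * A ^ 2 := by
        rw [mul_add, hfirst, inv_mul_cancel_left₀ hK'.ne', add_assoc]
    _ ≤ _ := by gcongr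
end

section
/- Let D, R be positive integers, ρ ≥ 0, let M ∈ ℝ^{R×R} be row-stochastic with a Perron vector p, and set λ = max_w Σ_v |M_{wv} − p_v|. Let y₁, …, y_R ∈ ℝ^D with weighted centroid ỹ = Σ_v p_v y_v, and suppose x₁, …, x_R ∈ ℝ^D satisfy, for every w, ‖x_w − Σ_v M_{wv} y_v‖ ≤ ρ · max_{v∈{1,…,R}} ‖y_v − Σ_u M_{wu} y_u‖. Then, with x̃ = Σ_w p_w x_w, max_{w∈{1,…,R}} ‖x_w − x̃‖ ≤ (4ρ + λ) · max_{w∈{1,…,R}} ‖y_w − ỹ‖. -/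
open Finset

section WeightedSums

variable {ι E : Type*} [Fintype ι] [SeminormedAddCommGroup E] [NormedSpace ℝ E]

theorem norm_sum_smul_le_sum_abs_mul (a : ι → ℝ) (z : ι → E) {C : ℝ} (hz : ∀ i, ‖z i‖ ≤ C) :
    ‖∑ i, a i • z i‖ ≤ (∑ i, |a i|) * C := by
  rw [Finset.sum_mul]
  refine norm_sum_le_of_le _ fun i _ => ?_
  rw [norm_smul, Real.norm_eq_abs]
  exact mul_le_mul_of_nonneg_left (hz i) (abs_nonneg _)

theorem norm_sum_smul_le_of_sum_eq_one {a : ι → ℝ} (ha : ∀ i, 0 ≤ a i) (ha1 : ∑ i, a i = 1)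
    (z : ι → E) {C : ℝ} (hz : ∀ i, ‖z i‖ ≤ C) : ‖∑ i, a i • z i‖ ≤ C := by
  simpa [abs_of_nonneg (ha _), ha1] using norm_sum_smul_le_sum_abs_mul a z hz

theorem sum_smul_sub_const_of_sum_eq_one {a : ι → ℝ} (ha1 : ∑ i, a i = 1) (z : ι → E) (c : E) :
    ∑ i, a i • (z i - c) = ∑ i, a i • z i - c := by
  simp only [smul_sub, Finset.sum_sub_distrib, ← Finset.sum_smul, ha1, one_smul]

/-- Averaging the rows of `M` against a left fixed vector `p` gives the `p`-weighted sum. -/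
theorem sum_smul_sum_smul_of_left_fixed {M : Matrix ι ι ℝ} {p : ι → ℝ}
    (hpM : ∀ v, ∑ w, p w * M w v = p v) (y : ι → E) :
    ∑ w, p w • ∑ v, M w v • y v = ∑ v, p v • y v := by
  simp only [Finset.smul_sum, smul_smul]
  rw [Finset.sum_comm]
  simp only [← Finset.sum_smul, hpM]

end WeightedSums

/-- One-step consensus contraction of a `(ρ, M)`-robust aggregator: if each `x_w` is
`ρ`-close to the mixed inputs `Σ_v M_{wv} y_v` (relative to the maximal deviation of the
inputs from the mixed inputs), then the maximal deviation of the outputs from their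
Perron-weighted centroid contracts by the factor `4ρ + λ`. -/
theorem robust_aggregator_one_step_contraction
    (D R : ℕ) (hD : 0 < D) (hR : 0 < R)
    (ρ : ℝ) (hρ : 0 ≤ ρ)
    (M : Matrix (Fin R) (Fin R) ℝ)
    (hMnonneg : ∀ w v, 0 ≤ M w v) (hMrow : ∀ w, ∑ v, M w v = 1)
    (p : Fin R → ℝ) (hp0 : ∀ w, 0 ≤ p w) (hp1 : ∑ w, p w = 1)
    (hpM : ∀ v, ∑ w, p w * M w v = p v)
    (mx : (Fin R → ℝ) → ℝ)
    (hmx : ∀ g : Fin R → ℝ, IsGreatest (Set.range g) (mx g))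
    (lam : ℝ) (hlam : lam = mx (fun w => ∑ v, |M w v - p v|))
    (y : Fin R → EuclideanSpace ℝ (Fin D))
    (yt : EuclideanSpace ℝ (Fin D)) (hyt : yt = ∑ v, p v • y v)
    (x : Fin R → EuclideanSpace ℝ (Fin D))
    (hagg : ∀ w, ‖x w - ∑ v, M w v • y v‖ ≤
      ρ * mx (fun v => ‖y v - ∑ u, M w u • y u‖))
    (xt : EuclideanSpace ℝ (Fin D)) (hxt : xt = ∑ w, p w • x w) :
    mx (fun w => ‖x w - xt‖) ≤ (4 * ρ + lam) * mx (fun w => ‖y w - yt‖) := by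
  have le_mx (g : Fin R → ℝ) (w : Fin R) : g w ≤ mx g := (hmx g).2 ⟨w, rfl⟩
  have mx_le {g : Fin R → ℝ} {C : ℝ} (h : ∀ w, g w ≤ C) : mx g ≤ C := by
    obtain ⟨w, hw⟩ := (hmx g).1
    exact hw ▸ h w
  set Y := mx (fun w => ‖y w - yt‖)
  set m : Fin R → EuclideanSpace ℝ (Fin D) := fun w => ∑ v, M w v • y v with hm
  have y_dev (v) : ‖y v - yt‖ ≤ Y := le_mx (fun w => ‖y w - yt‖) v
  have m_dev (w) : ‖m w - yt‖ ≤ Y := by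
    rw [hm, ← sum_smul_sub_const_of_sum_eq_one (hMrow w)]
    exact norm_sum_smul_le_of_sum_eq_one (hMnonneg w) (hMrow w) _ y_dev
  have x_dev (w) : ‖x w - m w‖ ≤ ρ * (2 * Y) := by
    refine (hagg w).trans (mul_le_mul_of_nonneg_left (mx_le fun v => ?_) hρ)
    have := norm_sub_le_norm_sub_add_norm_sub (y v) yt (m w)
    rw [norm_sub_rev yt] at this
    linarith [y_dev v, m_dev w]
  have centroid_dev : ‖xt - yt‖ ≤ ρ * (2 * Y) := by
    have : xt - yt = ∑ w, p w • (x w - m w) := by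
      simp only [smul_sub, Finset.sum_sub_distrib, hm, sum_smul_sum_smul_of_left_fixed hpM,
        hxt, hyt]
    rw [this]
    exact norm_sum_smul_le_of_sum_eq_one hp0 hp1 _ x_dev
  have m_contract (w) : ‖m w - yt‖ ≤ lam * Y := by
    have : m w - yt = ∑ v, (M w v - p v) • (y v - yt) := by
      simp only [sub_smul (M w _), Finset.sum_sub_distrib,
        sum_smul_sub_const_of_sum_eq_one (hMrow w), sum_smul_sub_const_of_sum_eq_one hp1, ← hyt,
        hm, sub_self, sub_zero]
    rw [this]
    refine (norm_sum_smul_le_sum_abs_mul _ _ y_dev).trans ?_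
    refine mul_le_mul_of_nonneg_right ?_ ((norm_nonneg _).trans (y_dev w))
    exact hlam ▸ le_mx (fun w => ∑ v, |M w v - p v|) w
  refine mx_le fun w => ?_
  have decomp : x w - xt = (x w - m w) + (m w - yt) - (xt - yt) := by abel
  calc ‖x w - xt‖ ≤ ‖x w - m w‖ + ‖m w - yt‖ + ‖xt - yt‖ := by
        rw [decomp]
        exact (norm_sub_le _ _).trans (add_le_add_left (norm_add_le _ _) _)
    _ ≤ ρ * (2 * Y) + lam * Y + ρ * (2 * Y) := by
        gcongr
        exacts [x_dev w, m_contract w]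
    _ = (4 * ρ + lam) * Y := by ring
end
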